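/- arXiv:1912.03600 — 3 statements merged into one kernel-verified Lean document; each statement's English description precedes it below -/
import Mathlib

section
/- Let I and J be finite index sets. For each i ∈ I let Q_i, Z_i ∈ ℝ (current virtual queue values) and C_i, u_i, γ_i, u_i^max ∈ ℝ with 0 ≤ u_i ≤ u_i^max, 0 ≤ γ_i ≤ u_i^max, 0 ≤ C_i ≤ u_i^max. For each j ∈ J let H_j ∈ ℝ and p_j, p_j^c, p̃_j, p̂_j ∈ ℝ with p_j ≥ 0, p_j^c ≥ 0, p_j + p_j^c ≤ p̂_j, 0 ≤ p̃_j ≤ p̂_j. Let V ≥ 0 and ρ ≥ 0. Define the updated queues Q_i' = Q_i + C_i − u_i, Z_i' = Z_i + γ_i − u_i, H_j' = H_j + (p_j + p_j^c) − p̃_j, the Lyapunov function L = ½∑_i([Q_i]⁺)^2 + ½∑_i([Z_i]⁺)^2 + ½∑_j([H_j]⁺)^2 and L' analogously from the updated queues, the drift Δ = L' − L, g = ∑_i log₂(1+γ_i), and B = ∑_i (u_i^max)^2 + ½∑_j (p̂_j)^2. Then Δ − V(g − ρ∑_j(p_j + p_j^c)) ≤ B + ∑_i [Q_i]⁺ C_i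 − ∑_j [H_j]⁺(p̃_j − p_j^c) + Vρ∑_j p_j^c − V∑_i log₂(1+γ_i) + ∑_i [Z_i]⁺ γ_i + ∑_j (Vρ + [H_j]⁺) p_j − ∑_i ([Q_i]⁺ + [Z_i]⁺) u_i. -/
open Finset Real

/-- One-step drift bound for a queue with arrival `x` and service `y`, both in `[0, m]`. -/
lemma sq_posPart_queue_update_le {a x y m : ℝ} (hx₀ : 0 ≤ x) (hx₁ : x ≤ m) (hy₀ : 0 ≤ y)
    (hy₁ : y ≤ m) :
    (max (a + x - y) 0) ^ 2 ≤ (max a 0) ^ 2 + 2 * (max a 0 * x - max a 0 * y) + m ^ 2 := by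
  have hd : (x - y) ^ 2 ≤ m ^ 2 := sq_le_sq' (by linarith) (by linarith)
  have hle : max (a + x - y) 0 ≤ |max a 0 + (x - y)| :=
    max_le (le_trans (by linarith [le_max_left a 0]) (le_abs_self _)) (abs_nonneg _)
  have hsq := pow_le_pow_left₀ (le_max_right (a + x - y) 0) hle 2
  rw [sq_abs] at hsq
  linarith

/-- The drift bound for a finite family of queues. -/
lemma sum_sq_posPart_queue_update_le {ι : Type*} [Fintype ι] (a x y m : ι → ℝ)
    (hx₀ : ∀ i, 0 ≤ x i) (hx₁ : ∀ i, x i ≤ m i) (hy₀ : ∀ i, 0 ≤ y i) (hy₁ : ∀ i, y i ≤ m i) :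
    ∑ i, (max (a i + x i - y i) 0) ^ 2 ≤ ∑ i, (max (a i) 0) ^ 2
      + 2 * (∑ i, max (a i) 0 * x i - ∑ i, max (a i) 0 * y i) + ∑ i, (m i) ^ 2 := by
  rw [← Finset.sum_sub_distrib, Finset.mul_sum, ← Finset.sum_add_distrib,
    ← Finset.sum_add_distrib]
  exact Finset.sum_le_sum fun i _ =>
    sq_posPart_queue_update_le (hx₀ i) (hx₁ i) (hy₀ i) (hy₁ i)

/-- Lemma 3 (drift-plus-penalty upper bound). -/
theorem drift_plus_penalty_upper_bound
    {I J : Type*} [Fintype I] [Fintype J]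
    (Q Z C u γ umax : I → ℝ) (H p pc ptilde phat : J → ℝ)
    (V ρ : ℝ) (hV : 0 ≤ V) (hρ : 0 ≤ ρ)
    (hu₀ : ∀ i, 0 ≤ u i) (hu₁ : ∀ i, u i ≤ umax i)
    (hγ₀ : ∀ i, 0 ≤ γ i) (hγ₁ : ∀ i, γ i ≤ umax i)
    (hC₀ : ∀ i, 0 ≤ C i) (hC₁ : ∀ i, C i ≤ umax i)
    (hp : ∀ j, 0 ≤ p j) (hpc : ∀ j, 0 ≤ pc j)
    (hphat : ∀ j, p j + pc j ≤ phat j)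
    (hptilde₀ : ∀ j, 0 ≤ ptilde j) (hptilde₁ : ∀ j, ptilde j ≤ phat j) :
    let Q' : I → ℝ := fun i => Q i + C i - u i
    let Z' : I → ℝ := fun i => Z i + γ i - u i
    let H' : J → ℝ := fun j => H j + (p j + pc j) - ptilde j
    let L : ℝ := (1/2) * ∑ i, (max (Q i) 0) ^ 2 + (1/2) * ∑ i, (max (Z i) 0) ^ 2
      + (1/2) * ∑ j, (max (H j) 0) ^ 2
    let L' : ℝ := (1/2) * ∑ i, (max (Q' i) 0) ^ 2 + (1/2) * ∑ i, (max (Z' i) 0) ^ 2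
      + (1/2) * ∑ j, (max (H' j) 0) ^ 2
    let Δ : ℝ := L' - L
    let g : ℝ := ∑ i, Real.logb 2 (1 + γ i)
    let B : ℝ := ∑ i, (umax i) ^ 2 + (1/2) * ∑ j, (phat j) ^ 2
    Δ - V * (g - ρ * ∑ j, (p j + pc j)) ≤
      B + ∑ i, max (Q i) 0 * C i - ∑ j, max (H j) 0 * (ptilde j - pc j)
        + V * ρ * ∑ j, pc j
        - V * ∑ i, Real.logb 2 (1 + γ i) + ∑ i, max (Z i) 0 * γ i
        + ∑ j, (V * ρ + max (H j) 0) * p j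
        - ∑ i, (max (Q i) 0 + max (Z i) 0) * u i := by
  intro Q' Z' H' L L' Δ g B
  have hQ := sum_sq_posPart_queue_update_le Q C u umax hC₀ hC₁ hu₀ hu₁
  have hZ := sum_sq_posPart_queue_update_le Z γ u umax hγ₀ hγ₁ hu₀ hu₁
  have hH := sum_sq_posPart_queue_update_le H (fun j => p j + pc j) ptilde phat
    (fun j => add_nonneg (hp j) (hpc j)) hphat hptilde₀ hptilde₁
  simp only [Δ, L, L', g, B, Q', Z', H', mul_add, add_mul, mul_sub, Finset.sum_add_distrib,
    Finset.sum_sub_distrib, ← Finset.mul_sum] at hQ hZ hH ⊢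
  linarith
end

section
/- Let a, b > 0 and define f(W) = W·(exp(a/W + b/√W) − 1) for W > 0. Then there exists a unique W^th > 0 at which f attains its minimum over (0, ∞); moreover the derivative of f satisfies f′(W) < 0 for 0 < W < W^th, f′(W^th) = 0, and f′(W) > 0 for W > W^th, so f is strictly decreasing on (0, W^th] and strictly increasing on [W^th, ∞). -/
open Real Set

/-- The sign of the derivative of `W(exp(a/W + b/√W) − 1)` is that of this function at `1/√W`. -/
noncomputable def derivSign (a b s : ℝ) : ℝ :=
  1 - a * s ^ 2 - b * s / 2 - Real.exp (-(a * s ^ 2 + b * s))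

theorem hasDerivAt_derivSign (a b s : ℝ) :
    HasDerivAt (derivSign a b)
      (-(2 * a * s) - b / 2 + (2 * a * s + b) * Real.exp (-(a * s ^ 2 + b * s))) s := by
  have h1 : HasDerivAt (fun s : ℝ => a * s ^ 2) (a * (2 * s)) s := by
    simpa using (hasDerivAt_pow 2 s).const_mul a
  have h2 : HasDerivAt (fun s : ℝ => b * s) b s := by
    simpa using (hasDerivAt_id s).const_mul b
  have h := ((h1.const_sub 1).sub (h2.div_const 2)).sub (h1.add h2).neg.exp
  refine h.congr_deriv ?_
  simp only [Pi.neg_apply, Pi.add_apply]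
  ring

theorem deriv_derivSign (a b : ℝ) :
    deriv (derivSign a b) =
      fun s => -(2 * a * s) - b / 2 + (2 * a * s + b) * Real.exp (-(a * s ^ 2 + b * s)) :=
  funext fun s => (hasDerivAt_derivSign a b s).deriv

theorem continuous_derivSign (a b : ℝ) : Continuous (derivSign a b) := by
  unfold derivSign
  fun_prop

theorem strictConcaveOn_derivSign {a b : ℝ} (ha : 0 < a) (hb : 0 < b) :
    StrictConcaveOn ℝ (Ici 0) (derivSign a b) := by
  refine strictConcaveOn_of_deriv2_neg (convex_Ici 0) (continuous_derivSign a b).continuousOn ?_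
  intro s hs
  rw [interior_Ici, mem_Ioi] at hs
  have h1 : HasDerivAt (fun s : ℝ => a * s ^ 2) (a * (2 * s)) s := by
    simpa using (hasDerivAt_pow 2 s).const_mul a
  have h2 : HasDerivAt (fun s : ℝ => b * s) b s := by
    simpa using (hasDerivAt_id s).const_mul b
  have h3 : HasDerivAt (fun s : ℝ => 2 * a * s) (2 * a) s := by
    simpa using (hasDerivAt_id s).const_mul (2 * a)
  have h := (h3.neg.sub_const (b / 2)).add ((h3.add_const b).mul (h1.add h2).neg.exp)
  have hd : deriv^[2] (derivSign a b) s =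
      -(2 * a * (1 - Real.exp (-(a * s ^ 2 + b * s)))) -
        (2 * a * s + b) ^ 2 * Real.exp (-(a * s ^ 2 + b * s)) := by
    rw [Function.iterate_succ, Function.iterate_one, Function.comp_apply, deriv_derivSign]
    refine (h.congr_deriv ?_).deriv
    simp only [Pi.neg_apply, Pi.add_apply]
    ring
  have he : Real.exp (-(a * s ^ 2 + b * s)) < 1 := by
    rw [Real.exp_lt_one_iff]
    have : 0 < a * s ^ 2 + b * s := by positivity
    linarith
  have hp : 0 < (2 * a * s + b) ^ 2 * Real.exp (-(a * s ^ 2 + b * s)) := by positivity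
  have hq : 0 < 2 * a * (1 - Real.exp (-(a * s ^ 2 + b * s))) :=
    mul_pos (by positivity) (by linarith)
  rw [hd]
  linarith

theorem derivSign_zero (a b : ℝ) : derivSign a b 0 = 0 := by
  simp [derivSign]

theorem exists_derivSign_eq_zero {a b : ℝ} (ha : 0 < a) (hb : 0 < b) :
    ∃ s, 0 < s ∧ derivSign a b s = 0 := by
  have hS : derivSign a b (2 / b) < 0 := by
    have h1 : b * (2 / b) / 2 = 1 := by field_simp
    have h2 : 0 < a * (2 / b) ^ 2 := by positivity
    have h3 := Real.exp_pos (-(a * (2 / b) ^ 2 + b * (2 / b)))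
    unfold derivSign
    linarith
  have hd : HasDerivAt (derivSign a b) (b / 2) 0 :=
    (hasDerivAt_derivSign a b 0).congr_deriv (by simp; ring)
  have hslope := (hasDerivAt_iff_tendsto_slope.1 hd).mono_left
    (nhdsWithin_mono (0 : ℝ) (fun x (hx : x ∈ Ioi (0 : ℝ)) => ne_of_gt hx))
  obtain ⟨r, hr, hr0, hrS⟩ := ((hslope.eventually (lt_mem_nhds (half_pos hb))).and
    (Ioo_mem_nhdsGT (show (0 : ℝ) < 2 / b by positivity))).exists
  have hrpos : 0 < derivSign a b r := by
    rw [slope_def_field, derivSign_zero, sub_zero, sub_zero] at hr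
    exact (div_pos_iff_of_pos_right hr0).1 hr
  obtain ⟨s, hs, hs0⟩ := intermediate_value_Icc' hrS.le
    (continuous_derivSign a b).continuousOn ⟨hS.le, hrpos.le⟩
  exact ⟨s, hr0.trans_le hs.1, hs0⟩

/-- A strictly concave function on `[0, ∞)` vanishing at `0` and at `s₀ > 0` is positive on
`(0, s₀)` and negative beyond `s₀`. -/
theorem StrictConcaveOn.sign_of_zeros {p : ℝ → ℝ} (hp : StrictConcaveOn ℝ (Ici 0) p)
    (h0 : p 0 = 0) {s₀ : ℝ} (hs₀ : 0 < s₀) (hz : p s₀ = 0) :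
    (∀ s, 0 < s → s < s₀ → 0 < p s) ∧ ∀ s, s₀ < s → p s < 0 := by
  constructor
  · intro s hs hlt
    have h := hp.slope_anti_adjacent self_mem_Ici (mem_Ici.2 hs₀.le) hs hlt
    rw [h0, hz, zero_sub, sub_zero, sub_zero] at h
    by_contra! hn
    have h1 : 0 ≤ -p s / (s₀ - s) := div_nonneg (by linarith) (by linarith)
    have h2 : p s / s ≤ 0 := div_nonpos_of_nonpos_of_nonneg hn hs.le
    linarith
  · intro s hs
    have h := hp.slope_anti_adjacent self_mem_Ici (mem_Ici.2 (hs₀.trans hs).le) hs₀ hs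
    rw [h0, hz, sub_zero, sub_zero, zero_div] at h
    by_contra! hn
    exact h.not_ge (div_nonneg hn (by linarith))

theorem hasDerivAt_power (a b : ℝ) {W : ℝ} (hW : 0 < W) :
    HasDerivAt (fun W => W * (Real.exp (a / W + b / Real.sqrt W) - 1))
      (Real.exp (a / W + b / Real.sqrt W) * derivSign a b (1 / Real.sqrt W)) W := by
  have hs : 0 < Real.sqrt W := Real.sqrt_pos.2 hW
  have hsq : Real.sqrt W ^ 2 = W := Real.sq_sqrt hW.le
  have h1 := (hasDerivAt_const W a).div (hasDerivAt_id W) hW.ne'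
  have h2 := (hasDerivAt_const W b).div (Real.hasDerivAt_sqrt hW.ne') hs.ne'
  have h := (hasDerivAt_id W).mul ((h1.add h2).exp.sub_const 1)
  refine h.congr_deriv ?_
  have hu : a * (1 / Real.sqrt W) ^ 2 + b * (1 / Real.sqrt W) = a / W + b / Real.sqrt W := by
    rw [div_pow, hsq]
    ring
  simp only [derivSign, hu, Real.exp_neg, Pi.add_apply, Pi.div_apply, id]
  have he := (Real.exp_pos (a / W + b / Real.sqrt W)).ne'
  generalize Real.exp (a / W + b / Real.sqrt W) = E at *
  generalize Real.sqrt W = r at *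
  subst hsq
  field_simp
  ring

/-- Lemma 4: the required URLLC transmit power `f(W) = W(exp(a/W + b/√W) − 1)`
is unimodal in the bandwidth `W > 0`, with a unique minimizer `Wᵗʰ`; its
derivative is negative below `Wᵗʰ`, zero at `Wᵗʰ`, positive above, and `f` is
strictly decreasing on `(0, Wᵗʰ]` and strictly increasing on `[Wᵗʰ, ∞)`. -/
theorem urllc_power_unimodal_in_bandwidth (a b : ℝ) (ha : 0 < a) (hb : 0 < b) :
    let f : ℝ → ℝ := fun W => W * (Real.exp (a / W + b / Real.sqrt W) - 1)
    ∃ Wth : ℝ, 0 < Wth ∧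
      (∀ W, 0 < W → f Wth ≤ f W) ∧
      (∀ W', 0 < W' → (∀ W, 0 < W → f W' ≤ f W) → W' = Wth) ∧
      (∀ W, 0 < W → W < Wth → deriv f W < 0) ∧
      deriv f Wth = 0 ∧
      (∀ W, Wth < W → 0 < deriv f W) ∧
      StrictAntiOn f (Set.Ioc 0 Wth) ∧
      StrictMonoOn f (Set.Ici Wth) := by
  intro f
  obtain ⟨s₀, hs₀, hz⟩ := exists_derivSign_eq_zero ha hb
  obtain ⟨hpos, hneg⟩ :=
    (strictConcaveOn_derivSign ha hb).sign_of_zeros (derivSign_zero a b) hs₀ hz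
  have hf : ∀ W, 0 < W → HasDerivAt f
      (Real.exp (a / W + b / Real.sqrt W) * derivSign a b (1 / Real.sqrt W)) W :=
    fun W hW => hasDerivAt_power a b hW
  have hT : 0 < (1 / s₀) ^ 2 := by positivity
  have hsqrt : Real.sqrt ((1 / s₀) ^ 2) = 1 / s₀ := Real.sqrt_sq (by positivity)
  have hdneg : ∀ W, 0 < W → W < (1 / s₀) ^ 2 → deriv f W < 0 := by
    intro W hW hlt
    rw [(hf W hW).deriv]
    refine mul_neg_of_pos_of_neg (Real.exp_pos _) (hneg _ ?_)
    have h := Real.sqrt_lt_sqrt hW.le hlt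
    rw [hsqrt] at h
    exact (lt_one_div (Real.sqrt_pos.2 hW) hs₀).1 h
  have hdpos : ∀ W, (1 / s₀) ^ 2 < W → 0 < deriv f W := by
    intro W hlt
    have hW := hT.trans hlt
    rw [(hf W hW).deriv]
    have hs := Real.sqrt_pos.2 hW
    refine mul_pos (Real.exp_pos _) (hpos _ (by positivity) ?_)
    have h := Real.sqrt_lt_sqrt hT.le hlt
    rw [hsqrt] at h
    exact (one_div_lt hs₀ hs).1 h
  have hanti : StrictAntiOn f (Ioc 0 ((1 / s₀) ^ 2)) := by
    refine strictAntiOn_of_deriv_neg (convex_Ioc _ _)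
      (fun W hW => (hf W hW.1).continuousAt.continuousWithinAt) fun W hW => ?_
    rw [interior_Ioc] at hW
    exact hdneg W hW.1 hW.2
  have hmono : StrictMonoOn f (Ici ((1 / s₀) ^ 2)) := by
    refine strictMonoOn_of_deriv_pos (convex_Ici _)
      (fun W hW => (hf W (hT.trans_le hW)).continuousAt.continuousWithinAt) fun W hW => ?_
    rw [interior_Ici] at hW
    exact hdpos W hW
  have hmin : ∀ W, 0 < W → W ≠ (1 / s₀) ^ 2 → f ((1 / s₀) ^ 2) < f W := by
    intro W hW hne
    rcases hne.lt_or_gt with h | h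
    · exact hanti ⟨hW, h.le⟩ ⟨hT, le_rfl⟩ h
    · exact hmono self_mem_Ici (mem_Ici.2 h.le) h
  refine ⟨(1 / s₀) ^ 2, hT, fun W hW => ?_, fun W hW hle => ?_, hdneg, ?_, hdpos, hanti, hmono⟩
  · rcases eq_or_ne W ((1 / s₀) ^ 2) with rfl | h
    · exact le_rfl
    · exact (hmin W hW h).le
  · by_contra hne
    exact (hmin W hW hne).not_ge (hle _ hT)
  · rw [(hf _ hT).deriv, hsqrt, one_div_one_div, hz, mul_zero]
end

section
/- Let a > 0, N₀ > 0, and I ≥ 0. The function f(W) = W·log₂(1 + a/(N₀·W + I)) is strictly increasing on (0, ∞). -/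
open Real Set

/-- The Shannon rate `f(W) = W·log₂(1 + a/(N₀W + I))` of an MBB user is strictly
increasing in the allocated bandwidth `W > 0`. -/
theorem shannon_rate_strictMono_in_bandwidth (a N₀ I : ℝ) (ha : 0 < a) (hN : 0 < N₀)
    (hI : 0 ≤ I) :
    StrictMonoOn (fun W : ℝ => W * Real.logb 2 (1 + a / (N₀ * W + I))) (Set.Ioi 0) := by
  intro x hx y hy hxy
  rw [mem_Ioi] at hx hy
  have hdx : 0 < N₀ * x + I := by positivity
  have hdy : 0 < N₀ * y + I := by positivity
  have hs : 0 < a / (N₀ * y + I) := by positivity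
  -- The signal-to-noise ratio falls by at most the factor `y / x`, so Bernoulli applies.
  have hsnr : a / (N₀ * x + I) ≤ y / x * (a / (N₀ * y + I)) := by
    rw [div_mul_div_comm, div_le_div_iff₀ hdx (by positivity)]
    nlinarith [mul_nonneg ha.le (mul_nonneg hI (sub_nonneg.2 hxy.le))]
  have hbernoulli :=
    one_add_mul_self_lt_rpow_one_add (by linarith) hs.ne' ((one_lt_div hx).2 hxy)
  have hlog : logb 2 (1 + a / (N₀ * x + I)) < y / x * logb 2 (1 + a / (N₀ * y + I)) := by
    rw [← logb_rpow_eq_mul_logb_of_pos (by positivity)]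
    exact logb_lt_logb one_lt_two (by positivity) (by linarith)
  calc x * logb 2 (1 + a / (N₀ * x + I))
      < x * (y / x * logb 2 (1 + a / (N₀ * y + I))) := mul_lt_mul_of_pos_left hlog hx
    _ = y * logb 2 (1 + a / (N₀ * y + I)) := by rw [← mul_assoc, mul_div_cancel₀ _ hx.ne']
end
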